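/- arXiv:1812.11565 — 6 statements merged into one kernel-verified Lean document; each statement's English description precedes it below -/
import Mathlib

section
/- Let u be a harmonic function on an open set V ⊆ ℝ² ≅ ℂ and let f = u_y + i u_x. Then f is complex differentiable (holomorphic) on V, with complex derivative f'(z) = u_{xy}(z) + i u_{xx}(z) at every z ∈ V. -/
open Complex Set Filter Topology

/-- Partial derivative in the `x` direction. -/
noncomputable def pX (g : ℂ → ℝ) : ℂ → ℝ := fun z => fderiv ℝ g z 1

/-- Partial derivative in the `y` direction. -/
noncomputable def pY (g : ℂ → ℝ) : ℂ → ℝ := fun z => fderiv ℝ g z Complex.I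

/-- Directional derivatives of a `C²` function are differentiable, with derivative given by the
second derivative. -/
theorem ContDiffAt.hasFDerivAt_fderiv_apply {E F : Type*}
    [NormedAddCommGroup E] [NormedSpace ℝ E] [NormedAddCommGroup F] [NormedSpace ℝ F]
    {g : E → F} {z : E} (hg : ContDiffAt ℝ 2 g z) (v : E) :
    HasFDerivAt (fun w => fderiv ℝ g w v) ((fderiv ℝ (fderiv ℝ g) z).flip v) z := by
  have hd : DifferentiableAt ℝ (fderiv ℝ g) z :=
    (hg.fderiv_right (m := 1) (by norm_num)).differentiableAt one_ne_zero
  simpa using hd.hasFDerivAt.clm_apply (hasFDerivAt_const v z)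

theorem stmt3
    (V : Set ℂ) (hV : IsOpen V)
    (u : ℂ → ℝ) (hu : ContDiffOn ℝ 2 u V)
    (hharm : ∀ z ∈ V, pX (pX u) z + pY (pY u) z = 0)
    (f : ℂ → ℂ) (hf : f = fun z => (pY u z : ℂ) + (pX u z : ℂ) * Complex.I) :
    ∀ z ∈ V, HasDerivAt f ((pX (pY u) z : ℂ) + (pX (pX u) z : ℂ) * Complex.I) z := by
  intro z hz
  subst hf
  have huz : ContDiffAt ℝ 2 u z := hu.contDiffAt (hV.mem_nhds hz)
  have hX : HasFDerivAt (pX u) _ z := huz.hasFDerivAt_fderiv_apply 1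
  have hY : HasFDerivAt (pY u) _ z := huz.hasFDerivAt_fderiv_apply I
  have hsymm : fderiv ℝ (fderiv ℝ u) z I 1 = fderiv ℝ (fderiv ℝ u) z 1 I :=
    huz.isSymmSndFDerivAt (by simp) I 1
  have hlap := hharm z hz
  rw [pX, pY, hX.fderiv, hY.fderiv] at hlap
  simp only [ContinuousLinearMap.flip_apply] at hlap
  rw [pX, pX, hX.fderiv, hY.fderiv]
  have hreal := (ofRealCLM.hasFDerivAt.comp z hY).add
    ((ofRealCLM.hasFDerivAt.comp z hX).mul_const I)
  rw [hasDerivAt_iff_hasFDerivAt]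
  refine hasFDerivAt_of_restrictScalars ℝ hreal ?_
  ext v
  have hdecomp : v = v.re • (1 : ℂ) + v.im • I := by simp [re_add_im]
  generalize v.re = a, v.im = b at hdecomp
  subst hdecomp
  rw [map_add, map_add, map_smul, map_smul, map_smul, map_smul]
  apply Complex.ext
  · simp [hsymm]
    linear_combination -b * hlap
  · simp [hsymm]
end

section
/- Let Ω be a bounded open set in ℝ² ≅ ℂ whose boundary ∂Ω is the image of a positively oriented simple closed C¹ curve γ. Let u be harmonic on an open neighborhood of ∂Ω, set f = u_y + i u_x and p = u_x² + u_y², and assume p > 0 on ∂Ω. Then (1/(2πi)) ∮_γ (f'/f) dz = (1/(4π)) ∫_{∂Ω} (∂/∂ν) log p dτ = (1/(2π)) ∫_{∂Ω} q/(2p) dτ, where q = ∂p/∂ν, ν is the outward unit normal on ∂Ω, and dτ denotes arc length. -/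
open Complex Set Filter Topology MeasureTheory

open InnerProductSpace in
theorem harmonicAt_of_pX_pY {u : ℂ → ℝ} {W : Set ℂ} (hW : IsOpen W) (hu : ContDiffOn ℝ 2 u W)
    (h : ∀ z ∈ W, pX (pX u) z + pY (pY u) z = 0) {z : ℂ} (hz : z ∈ W) : HarmonicAt u z := by
  have hu' : ∀ w ∈ W, ContDiffAt ℝ 2 u w := fun w hw => hu.contDiffAt (hW.mem_nhds hw)
  refine ⟨hu' z hz, ?_⟩
  filter_upwards [hW.mem_nhds hz] with w hw
  have hd : DifferentiableAt ℝ (fderiv ℝ u) w :=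
    ((hu' w hw).fderiv_right (m := 1) (by norm_num)).differentiableAt (by norm_num)
  have key : ∀ v : ℂ, fderiv ℝ (fun z => fderiv ℝ u z v) w v = fderiv ℝ (fderiv ℝ u) w v v := by
    intro v
    rw [fderiv_clm_apply hd (by fun_prop)]
    simp
  have := h w hw
  unfold pX pY at this
  rw [key, key] at this
  simpa [laplacian_eq_iteratedFDeriv_complexPlane, iteratedFDeriv_two_apply] using this

theorem im_sq_add_re_sq_ne_zero {z : ℂ} (hz : z ≠ 0) : z.im ^ 2 + z.re ^ 2 ≠ 0 := by
  have := normSq_pos.2 hz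
  rw [normSq_apply] at this
  nlinarith

theorem hasFDerivAt_im_sq_add_re_sq {f : ℂ → ℂ} {f' z : ℂ} (hf : HasDerivAt f f' z) :
    ∃ L : ℂ →L[ℝ] ℝ, HasFDerivAt (fun w => (f w).im ^ 2 + (f w).re ^ 2) L z ∧
      (f z ≠ 0 → ∀ v, L v / ((f z).im ^ 2 + (f z).re ^ 2) = 2 * (f' / f z * v).re) := by
  have h := hf.hasFDerivAt.restrictScalars ℝ
  have hre := (reCLM.hasFDerivAt (x := f z)).comp z h
  have him := (imCLM.hasFDerivAt (x := f z)).comp z h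
  refine ⟨_, (him.pow 2).add (hre.pow 2), fun h0 v => ?_⟩
  have hn := im_sq_add_re_sq_ne_zero h0
  have hn' : normSq (f z) = (f z).im ^ 2 + (f z).re ^ 2 := by rw [normSq_apply]; ring
  simp [Complex.div_re, Complex.div_im, hn']
  field_simp
  ring

theorem intervalIntegral_re_logDeriv_eq_zero {f : ℂ → ℂ} {γ : ℝ → ℂ} {a b : ℝ} (hab : a < b)
    (hγ : ContDiff ℝ 1 γ) (hclosed : γ a = γ b)
    (hf : ∀ t ∈ Icc a b, AnalyticAt ℂ f (γ t)) (h0 : ∀ t ∈ Icc a b, f (γ t) ≠ 0) :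
    ContinuousOn (fun t => deriv f (γ t) / f (γ t) * deriv γ t) (uIcc a b) ∧
      ∫ t in a..b, (deriv f (γ t) / f (γ t) * deriv γ t).re = 0 := by
  have hc : ContinuousOn (fun t => deriv f (γ t) / f (γ t) * deriv γ t) (uIcc a b) := by
    rw [uIcc_of_le hab.le]
    intro t ht
    have h1 : ContinuousAt (fun t => deriv f (γ t)) t :=
      (hf t ht).deriv.continuousAt.comp hγ.continuous.continuousAt
    have h2 : ContinuousAt (fun t => f (γ t)) t :=
      (hf t ht).continuousAt.comp hγ.continuous.continuousAt
    exact ((h1.div h2 (h0 t ht)).mul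
      (hγ.continuous_deriv (le_refl _)).continuousAt).continuousWithinAt
  refine ⟨hc, ?_⟩
  have hd : ∀ t ∈ uIcc a b, HasDerivAt
      (fun t => Real.log ((f (γ t)).im ^ 2 + (f (γ t)).re ^ 2) / 2)
      (deriv f (γ t) / f (γ t) * deriv γ t).re t := by
    intro t ht
    rw [uIcc_of_le hab.le] at ht
    obtain ⟨L, hL, hLv⟩ := hasFDerivAt_im_sq_add_re_sq (hf t ht).differentiableAt.hasDerivAt
    have hγt := (hγ.differentiable (by norm_num) t).hasDerivAt
    have hne := im_sq_add_re_sq_ne_zero (h0 t ht)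
    have h3 := ((hL.comp_hasDerivAt t hγt).log hne).div_const 2
    refine h3.congr_deriv ?_
    have := hLv (h0 t ht) (deriv γ t)
    simp only [Function.comp] at *
    rw [this]; ring
  rw [intervalIntegral.integral_eq_sub_of_hasDerivAt hd
    (reCLM.continuous.comp_continuousOn hc).intervalIntegrable, hclosed, sub_self]

theorem stmt5
    -- Ω is a bounded open set in the plane
    (Ω : Set ℂ) (hΩo : IsOpen Ω) (hΩb : Bornology.IsBounded Ω)
    -- γ is a positively oriented simple closed C¹ (regular) curve with image ∂Ω
    (a b : ℝ) (hab : a < b) (γ : ℝ → ℂ)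
    (hγC1 : ContDiff ℝ 1 γ)
    (hγclosed : γ a = γ b) (hγsimple : Set.InjOn γ (Set.Ico a b))
    (hγreg : ∀ t ∈ Set.Icc a b, deriv γ t ≠ 0)
    (hγfr : frontier Ω = γ '' Set.Icc a b)
    (hγpos : ∀ w ∈ Ω,
      (1 / (2 * Real.pi * Complex.I)) * ∫ t in a..b, deriv γ t / (γ t - w) = 1)
    -- u is harmonic on an open neighborhood W of ∂Ω
    (W : Set ℂ) (hWo : IsOpen W) (hW : frontier Ω ⊆ W)
    (u : ℂ → ℝ) (hu : ContDiffOn ℝ 2 u W)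
    (hharm : ∀ z ∈ W, pX (pX u) z + pY (pY u) z = 0)
    -- f = u_y + i u_x and p = u_x² + u_y², with p > 0 on ∂Ω
    (f : ℂ → ℂ) (hf : f = fun z => (pY u z : ℂ) + (pX u z : ℂ) * Complex.I)
    (p : ℂ → ℝ) (hp : p = fun z => (pX u z) ^ 2 + (pY u z) ^ 2)
    (hppos : ∀ z ∈ frontier Ω, 0 < p z)
    -- ν is the outward unit normal along γ, q = ∂p/∂ν
    (ν : ℝ → ℂ) (hν : ν = fun t => (-Complex.I * deriv γ t) / (‖deriv γ t‖ : ℂ))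
    (q : ℝ → ℝ) (hq : q = fun t => fderiv ℝ p (γ t) (ν t)) :
    (1 / (2 * Real.pi * Complex.I)) *
        (∫ t in a..b, (deriv f (γ t) / f (γ t)) * deriv γ t)
      = (((1 / (4 * Real.pi)) *
          ∫ t in a..b, fderiv ℝ (fun z => Real.log (p z)) (γ t) (ν t) * ‖deriv γ t‖ : ℝ) : ℂ)
    ∧ (1 / (4 * Real.pi)) *
        (∫ t in a..b, fderiv ℝ (fun z => Real.log (p z)) (γ t) (ν t) * ‖deriv γ t‖)
      = (1 / (2 * Real.pi)) *
        ∫ t in a..b, (q t / (2 * p (γ t))) * ‖deriv γ t‖ := by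
  have hmem : ∀ t ∈ Icc a b, γ t ∈ frontier Ω := fun t ht => hγfr ▸ mem_image_of_mem γ ht
  have hfa : ∀ t ∈ Icc a b, AnalyticAt ℂ f (γ t) := by
    intro t ht
    have h := HarmonicAt.analyticAt_complex_partial
      (harmonicAt_of_pX_pY hWo hu hharm (hW (hmem t ht)))
    refine ((analyticAt_const (v := Complex.I)).mul h).congr (Eventually.of_forall fun z => ?_)
    rw [hf]
    simp only [pX, pY, Pi.mul_apply]
    linear_combination (-(fderiv ℝ u z Complex.I : ℂ)) * Complex.I_sq
  have hpf : p = fun z => (f z).im ^ 2 + (f z).re ^ 2 := by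
    rw [hp, hf]; simp
  have hf0 : ∀ t ∈ Icc a b, f (γ t) ≠ 0 := by
    intro t ht h0
    have := hppos _ (hmem t ht)
    simp [hpf, h0] at this
  have hlog : ∀ t ∈ Icc a b, fderiv ℝ (fun z => Real.log (p z)) (γ t) (ν t) =
      q t / p (γ t) ∧ q t / p (γ t) * ‖deriv γ t‖ =
        2 * (deriv f (γ t) / f (γ t) * deriv γ t).im := by
    intro t ht
    obtain ⟨L, hL, hLv⟩ := hasFDerivAt_im_sq_add_re_sq (hfa t ht).differentiableAt.hasDerivAt
    have hp0 := (hppos _ (hmem t ht)).ne'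
    rw [← hpf] at hL
    have hqL : q t = L (ν t) := by simp only [hq, hL.fderiv]
    refine ⟨?_, ?_⟩
    · rw [(hL.log hp0).fderiv, hqL]
      simp [div_eq_inv_mul]
    · have hn : (‖deriv γ t‖ : ℂ) ≠ 0 := by exact_mod_cast norm_ne_zero_iff.2 (hγreg t ht)
      have h1 := hLv (hf0 t ht) (ν t)
      have h2 : (deriv f (γ t) / f (γ t) * ν t) * (‖deriv γ t‖ : ℂ) =
          -Complex.I * (deriv f (γ t) / f (γ t) * deriv γ t) := by
        rw [hν]; field_simp
      have h3 := congrArg Complex.re h2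
      rw [Complex.re_mul_ofReal] at h3
      have h4 : p (γ t) = (f (γ t)).im ^ 2 + (f (γ t)).re ^ 2 := by rw [hpf]
      rw [hqL, h4, h1, mul_assoc, h3]
      simp
  obtain ⟨hc, hre⟩ := intervalIntegral_re_logDeriv_eq_zero hab hγC1 hγclosed hfa hf0
  constructor
  · have him : ∫ t in a..b, fderiv ℝ (fun z => Real.log (p z)) (γ t) (ν t) * ‖deriv γ t‖ =
        2 * (∫ t in a..b, deriv f (γ t) / f (γ t) * deriv γ t).im := by
      rw [← imCLM_apply, ← imCLM.intervalIntegral_comp_comm hc.intervalIntegrable,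
        ← intervalIntegral.integral_const_mul]
      refine intervalIntegral.integral_congr fun t ht => ?_
      rw [uIcc_of_le hab.le] at ht
      simp only [(hlog t ht).1, (hlog t ht).2, imCLM_apply]
    have hre' : (∫ t in a..b, deriv f (γ t) / f (γ t) * deriv γ t).re = 0 := by
      rw [← reCLM_apply, ← reCLM.intervalIntegral_comp_comm hc.intervalIntegrable]
      exact hre
    rw [him]
    generalize (∫ t in a..b, deriv f (γ t) / f (γ t) * deriv γ t) = J at hre' ⊢
    obtain ⟨x, y⟩ := J
    simp only at hre' ⊢
    subst hre'
    have : (⟨0, y⟩ : ℂ) = y * Complex.I := by apply Complex.ext <;> simp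
    rw [this]
    have hpi : (Real.pi : ℂ) ≠ 0 := by exact_mod_cast Real.pi_ne_zero
    push_cast
    field_simp
    ring
  · rw [← intervalIntegral.integral_const_mul, ← intervalIntegral.integral_const_mul]
    refine intervalIntegral.integral_congr fun t ht => ?_
    rw [uIcc_of_le hab.le] at ht
    simp only [(hlog t ht).1]
    have hp0 := (hppos _ (hmem t ht)).ne'
    field_simp
    ring
end

section
/- Let z₀ ∈ ℂ, let u be a harmonic function on an open disk around z₀, let f = u_y + i u_x, let n ≥ 1 be an integer, and let c₁, c₂ ∈ ℝ be constants, not both zero, such that f(z) = (c₂ + i c₁)(z − z₀)^{n−1} + o(|z − z₀|^{n−1}) as z → z₀. Then u(z) − u(z₀) = (1/n) Re((c₁ − i c₂)(z − z₀)ⁿ) + o(|z − z₀|ⁿ) as z → z₀; equivalently, writing z − z₀ = ρe^{iθ}, u(z) − u(z₀) = (ρⁿ/n)(c₁ cos nθ + c₂ sin nθ) + o(ρⁿ). In particular u − u(z₀) = O(ρⁿ) and u − u(z₀) = o(ρ^{n−1}) as ρ → 0. -/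
open Complex Set Filter Topology Asymptotics

/-- If the derivative of `w` is `o(‖z - z₀‖ ^ m)` at `z₀`, then the increment `w z - w z₀` is
`o(‖z - z₀‖ ^ (m + 1))`. -/
theorem isLittleO_sub_pow_succ_of_hasFDerivAt {E F : Type*}
    [NormedAddCommGroup E] [NormedSpace ℝ E] [NormedAddCommGroup F] [NormedSpace ℝ F]
    {w : E → F} {w' : E → E →L[ℝ] F} {z₀ : E} {m : ℕ}
    (hw : ∀ᶠ z in 𝓝 z₀, HasFDerivAt w (w' z) z)
    (hw' : w' =o[𝓝 z₀] fun z => ‖z - z₀‖ ^ m) :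
    (fun z => w z - w z₀) =o[𝓝 z₀] fun z => ‖z - z₀‖ ^ (m + 1) := by
  refine IsLittleO.of_bound fun ε hε => ?_
  obtain ⟨δ, hδ, hball⟩ := Metric.eventually_nhds_iff_ball.1 (hw.and (hw'.bound hε))
  filter_upwards [Metric.ball_mem_nhds z₀ hδ] with z hz
  have hsub : ∀ x ∈ Metric.closedBall z₀ ‖z - z₀‖, x ∈ Metric.ball z₀ δ := fun x hx =>
    (Metric.mem_closedBall.1 hx).trans_lt (mem_ball_iff_norm.1 hz)
  have key := (convex_closedBall z₀ ‖z - z₀‖).norm_image_sub_le_of_norm_hasFDerivWithin_le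
    (f := w) (f' := w') (C := ε * ‖z - z₀‖ ^ m) (x := z₀) (y := z)
    (fun x hx => (hball x (hsub x hx)).1.hasFDerivWithinAt)
    (fun x hx => (hball x (hsub x hx)).2.trans ?_)
    (Metric.mem_closedBall_self (norm_nonneg _)) (mem_closedBall_iff_norm.2 le_rfl)
  · simpa [pow_succ, mul_assoc] using key
  · have hx' := mem_closedBall_iff_norm.1 hx
    rw [norm_pow, norm_norm]
    gcongr

/-- The real differential of `u` in terms of its partial derivatives. -/
theorem fderiv_apply_eq_pX_pY (u : ℂ → ℝ) (z v : ℂ) :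
    fderiv ℝ u z v = v.re * pX u z + v.im * pY u z := by
  have hv : v = v.re • (1 : ℂ) + v.im • Complex.I := by
    simp [Complex.re_add_im]
  conv_lhs => rw [hv]
  simp only [map_add, map_smul, smul_eq_mul, pX, pY]

/-- The real differential of `z ↦ Re (a (z - z₀) ^ n) / n`. -/
theorem hasFDerivAt_re_mul_sub_pow (a z₀ z : ℂ) {n : ℕ} (hn : n ≠ 0) :
    HasFDerivAt (fun z => (1 / (n : ℝ)) * (a * (z - z₀) ^ n).re)
      (Complex.reCLM.comp
        ((ContinuousLinearMap.toSpanSingleton ℂ (a * (z - z₀) ^ (n - 1))).restrictScalars ℝ)) z := by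
  have hn' : (n : ℂ) ≠ 0 := Nat.cast_ne_zero.2 hn
  have h : HasDerivAt (fun z => (n : ℂ)⁻¹ * (a * (z - z₀) ^ n)) (a * (z - z₀) ^ (n - 1)) z := by
    refine (((((hasDerivAt_id' z).sub_const z₀).fun_pow n).const_mul a).const_mul
      (n : ℂ)⁻¹).congr_deriv ?_
    field_simp
  refine (Complex.reCLM.hasFDerivAt.comp z (h.hasFDerivAt.restrictScalars ℝ)).congr_of_eventuallyEq
    (Eventually.of_forall fun z => ?_)
  have hcast : (n : ℂ)⁻¹ = ((1 / (n : ℝ) : ℝ) : ℂ) := by simp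
  simp only [Function.comp, Complex.reCLM_apply, hcast, Complex.re_ofReal_mul]

theorem stmt6
    (z₀ : ℂ) (r : ℝ) (hr : 0 < r)
    (u : ℂ → ℝ) (hu : ContDiffOn ℝ 2 u (Metric.ball z₀ r))
    (hharm : ∀ z ∈ Metric.ball z₀ r, pX (pX u) z + pY (pY u) z = 0)
    (f : ℂ → ℂ) (hf : f = fun z => (pY u z : ℂ) + (pX u z : ℂ) * Complex.I)
    (n : ℕ) (hn : 1 ≤ n)
    (c₁ c₂ : ℝ) (hc : c₁ ≠ 0 ∨ c₂ ≠ 0)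
    (hasymp : (fun z => f z - ((c₂ : ℂ) + (c₁ : ℂ) * Complex.I) * (z - z₀) ^ (n - 1))
      =o[𝓝 z₀] fun z => ‖z - z₀‖ ^ (n - 1)) :
    ((fun z => u z - u z₀ - (1 / (n : ℝ)) *
        (((c₁ : ℂ) - (c₂ : ℂ) * Complex.I) * (z - z₀) ^ n).re)
      =o[𝓝 z₀] fun z => ‖z - z₀‖ ^ n)
    ∧ ((fun z => u z - u z₀) =O[𝓝 z₀] fun z => ‖z - z₀‖ ^ n)
    ∧ ((fun z => u z - u z₀) =o[𝓝 z₀] fun z => ‖z - z₀‖ ^ (n - 1)) := by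
  have hn0 : n ≠ 0 := Nat.one_le_iff_ne_zero.1 hn
  set a : ℂ := (c₁ : ℂ) - (c₂ : ℂ) * Complex.I with ha
  have hdiff : ∀ᶠ z in 𝓝 z₀, HasFDerivAt (fun z => u z - (1 / (n : ℝ)) * (a * (z - z₀) ^ n).re)
      (fderiv ℝ u z - Complex.reCLM.comp
        ((ContinuousLinearMap.toSpanSingleton ℂ (a * (z - z₀) ^ (n - 1))).restrictScalars ℝ)) z := by
    filter_upwards [Metric.ball_mem_nhds z₀ hr] with z hz
    exact ((hu.contDiffAt (Metric.isOpen_ball.mem_nhds hz)).differentiableAt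
      two_ne_zero).hasFDerivAt.sub (hasFDerivAt_re_mul_sub_pow a z₀ z hn0)
  have hderiv : (fun z => fderiv ℝ u z - Complex.reCLM.comp
      ((ContinuousLinearMap.toSpanSingleton ℂ (a * (z - z₀) ^ (n - 1))).restrictScalars ℝ))
      =o[𝓝 z₀] fun z => ‖z - z₀‖ ^ (n - 1) := by
    refine (IsBigO.of_bound' (Eventually.of_forall fun z => ?_)).trans_isLittleO hasymp
    refine ContinuousLinearMap.opNorm_le_bound _ (norm_nonneg _) fun v => ?_
    have him : (fderiv ℝ u z - Complex.reCLM.comp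
        ((ContinuousLinearMap.toSpanSingleton ℂ (a * (z - z₀) ^ (n - 1))).restrictScalars ℝ)) v
        = ((f z - ((c₂ : ℂ) + (c₁ : ℂ) * Complex.I) * (z - z₀) ^ (n - 1)) * v).im := by
      simp [fderiv_apply_eq_pX_pY, hf, ha]
      ring
    rw [him, ← norm_mul]
    exact Complex.abs_im_le_norm _
  have hmain : (fun z => u z - u z₀ - (1 / (n : ℝ)) * (a * (z - z₀) ^ n).re)
      =o[𝓝 z₀] fun z => ‖z - z₀‖ ^ n := by
    have h := isLittleO_sub_pow_succ_of_hasFDerivAt hdiff hderiv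
    rw [Nat.sub_add_cancel hn] at h
    refine h.congr_left fun z => ?_
    simp only [sub_self, zero_pow hn0, mul_zero, Complex.zero_re, sub_zero]
    ring
  have hre : (fun z => (1 / (n : ℝ)) * (a * (z - z₀) ^ n).re)
      =O[𝓝 z₀] fun z => ‖z - z₀‖ ^ n := by
    refine IsBigO.const_mul_left (IsBigO.of_bound ‖a‖ (Eventually.of_forall fun z => ?_)) _
    rw [norm_pow, norm_norm, ← norm_pow, ← norm_mul]
    exact Complex.abs_re_le_norm _
  have hO : (fun z => u z - u z₀) =O[𝓝 z₀] fun z => ‖z - z₀‖ ^ n :=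
    (hmain.isBigO.add hre).congr_left fun z => sub_add_cancel _ _
  refine ⟨hmain, hO, hO.trans_isLittleO ?_⟩
  have ht : Tendsto (fun z => ‖z - z₀‖) (𝓝 z₀) (𝓝 0) := tendsto_norm_sub_self z₀
  exact (isLittleO_pow_pow (𝕜 := ℝ) (Nat.sub_lt hn one_pos)).comp_tendsto ht
end

section
/- Let z₀ ∈ ℂ, let u be a harmonic function on a punctured open disk around z₀, let f = u_y + i u_x, let n ≤ −1 be an integer, and let c₁, c₂ ∈ ℝ be constants, not both zero, such that f(z) = (c₂ + i c₁)(z − z₀)^{n−1} + o(|z − z₀|^{n−1}) as z → z₀. Then u(z) = (1/n) Re((c₁ − i c₂)(z − z₀)ⁿ) + o(|z − z₀|ⁿ) as z → z₀; equivalently, writing z − z₀ = ρe^{iθ}, u(z) = (ρⁿ/n)(c₁ cos nθ + c₂ sin nθ) + o(ρⁿ) as ρ → 0. -/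
open Complex Set Filter Topology Asymptotics

/-- One-sided integration of the bound `-ε t ^ (n - 1) ≤ φ' t` over `[ρ, R]`. -/
lemma le_add_zpow_of_neg_le_deriv {φ φ' : ℝ → ℝ} {ρ R ε : ℝ} {n : ℤ} (hρ : 0 < ρ) (hρR : ρ ≤ R)
    (hε : 0 ≤ ε) (hn : n ≤ -1) (hφ : ∀ t ∈ Icc ρ R, HasDerivAt φ (φ' t) t)
    (hb : ∀ t ∈ Icc ρ R, -(ε * t ^ (n - 1)) ≤ φ' t) : φ ρ ≤ φ R + ε * ρ ^ n := by
  have hn' : (n : ℝ) ≤ -1 := by exact_mod_cast hn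
  have hn0 : (n : ℝ) ≠ 0 := by linarith
  have hd : ∀ t ∈ Icc ρ R,
      HasDerivAt (fun t => φ t + ε / n * t ^ n) (φ' t + ε * t ^ (n - 1)) t := by
    intro t ht
    have ht0 : t ≠ 0 := (hρ.trans_le ht.1).ne'
    exact ((hφ t ht).add ((hasDerivAt_zpow n t (Or.inl ht0)).const_mul (ε / n))).congr_deriv
      (by field_simp)
  have hmono : MonotoneOn (fun t => φ t + ε / n * t ^ n) (Icc ρ R) := by
    refine monotoneOn_of_deriv_nonneg (convex_Icc ρ R)
      (fun t ht => (hd t ht).continuousAt.continuousWithinAt)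
      (fun t ht => (hd t (interior_subset ht)).differentiableAt.differentiableWithinAt) ?_
    intro t ht
    rw [(hd t (interior_subset ht)).deriv]
    linarith [hb t (interior_subset ht)]
  have key := hmono (left_mem_Icc.2 hρR) (right_mem_Icc.2 hρR) hρR
  simp only at key
  have hc : ε / n ≤ 0 := div_nonpos_of_nonneg_of_nonpos hε (by linarith)
  have hc' : -ε ≤ ε / n := by
    rw [le_div_iff_of_neg (by linarith)]
    nlinarith
  have h1 : ε / n * R ^ n ≤ 0 :=
    mul_nonpos_of_nonpos_of_nonneg hc (zpow_nonneg (hρ.le.trans hρR) n)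
  have h2 : -ε * ρ ^ n ≤ ε / n * ρ ^ n := mul_le_mul_of_nonneg_right hc' (zpow_nonneg hρ.le n)
  linarith

lemma abs_le_abs_add_zpow_of_abs_deriv_le {φ φ' : ℝ → ℝ} {ρ R ε : ℝ} {n : ℤ} (hρ : 0 < ρ)
    (hρR : ρ ≤ R) (hε : 0 ≤ ε) (hn : n ≤ -1) (hφ : ∀ t ∈ Icc ρ R, HasDerivAt φ (φ' t) t)
    (hb : ∀ t ∈ Icc ρ R, |φ' t| ≤ ε * t ^ (n - 1)) : |φ ρ| ≤ |φ R| + ε * ρ ^ n := by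
  have h1 := le_add_zpow_of_neg_le_deriv hρ hρR hε hn hφ fun t ht => (abs_le.1 (hb t ht)).1
  have h2 := le_add_zpow_of_neg_le_deriv (φ := fun t => -φ t) hρ hρR hε hn
    (fun t ht => (hφ t ht).neg) fun t ht => neg_le_neg (abs_le.1 (hb t ht)).2
  rw [abs_le]
  constructor <;> linarith [le_abs_self (φ R), neg_abs_le (φ R)]

/-- A function whose derivative is `o(‖z - z₀‖ ^ (n - 1))`, with `n ≤ -1`, near a puncture `z₀` is
itself `o(‖z - z₀‖ ^ n)`. -/
lemma isLittleO_zpow_of_fderiv_isLittleO {E : Type*} [NormedAddCommGroup E] [NormedSpace ℝ E]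
    [ProperSpace E] {z₀ : E} {n : ℤ} (hn : n ≤ -1) {v : E → ℝ} {v' : E → E →L[ℝ] ℝ}
    (hv : ∀ᶠ z in 𝓝[≠] z₀, HasFDerivAt v (v' z) z)
    (ho : v' =o[𝓝[≠] z₀] fun z => ‖z - z₀‖ ^ (n - 1)) :
    v =o[𝓝[≠] z₀] fun z => ‖z - z₀‖ ^ n := by
  rw [isLittleO_iff]
  intro ε hε
  obtain ⟨δ, hδ, hball⟩ := Metric.mem_nhdsWithin_iff.1 (hv.and (isLittleO_iff.1 ho (half_pos hε)))
  have hδ' : ∀ z, 0 < ‖z - z₀‖ → ‖z - z₀‖ < δ →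
      HasFDerivAt v (v' z) z ∧ ‖v' z‖ ≤ ε / 2 * ‖z - z₀‖ ^ (n - 1) := by
    intro z h0 h1
    have := hball ⟨mem_ball_iff_norm.2 h1, sub_ne_zero.1 (norm_pos_iff.1 h0)⟩
    refine ⟨this.1, this.2.trans_eq ?_⟩
    rw [Real.norm_of_nonneg (zpow_nonneg (norm_nonneg _) _)]
  set R := δ / 2 with hR
  have hRpos : 0 < R := half_pos hδ
  have hRδ : R < δ := half_lt_self hδ
  obtain ⟨M, hM⟩ := (isCompact_sphere z₀ R).exists_bound_of_continuousOn (f := v) fun z hz => by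
    rw [mem_sphere_iff_norm] at hz
    exact (hδ' z (by rwa [hz]) (by rwa [hz])).1.continuousAt.continuousWithinAt
  have htend : Tendsto (fun z => ‖z - z₀‖ ^ n) (𝓝[≠] z₀) atTop := by
    obtain ⟨k, rfl⟩ : ∃ k : ℕ, n = -((k + 1 : ℕ) : ℤ) := ⟨(-n - 1).toNat, by omega⟩
    have h := (tendsto_pow_atTop (α := ℝ) (Nat.succ_ne_zero k)).comp
      (tendsto_inv_nhdsGT_zero.comp (tendsto_norm_sub_self_nhdsNE z₀))
    refine h.congr fun z => ?_
    simp only [Function.comp, zpow_neg, zpow_natCast, inv_pow]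
  filter_upwards [htend.eventually_ge_atTop (M / (ε / 2)), self_mem_nhdsWithin,
    mem_nhdsWithin_of_mem_nhds (Metric.ball_mem_nhds z₀ hRpos)] with z hzM hz0 hzR
  have hρ : 0 < ‖z - z₀‖ := norm_pos_iff.2 (sub_ne_zero.2 hz0)
  rw [mem_ball_iff_norm] at hzR
  set ρ := ‖z - z₀‖ with hρdef
  set e : E := ρ⁻¹ • (z - z₀) with he
  have hen : ‖e‖ = 1 := by
    rw [he, norm_smul, norm_inv, Real.norm_of_nonneg hρ.le, ← hρdef, inv_mul_cancel₀ hρ.ne']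
  have hnorm : ∀ t : ℝ, 0 < t → ‖z₀ + t • e - z₀‖ = t := fun t ht => by
    rw [add_sub_cancel_left, norm_smul, hen, mul_one, Real.norm_of_nonneg ht.le]
  have hz : z₀ + ρ • e = z := by
    rw [he, smul_smul, mul_inv_cancel₀ hρ.ne', one_smul, add_sub_cancel]
  have hmain := abs_le_abs_add_zpow_of_abs_deriv_le (φ := fun t => v (z₀ + t • e))
    (φ' := fun t => v' (z₀ + t • e) e) hρ hzR.le (half_pos hε).le hn
    (fun t ht => by
      have ht0 := hρ.trans_le ht.1
      have hl : HasDerivAt (fun t : ℝ => z₀ + t • e) e t := by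
        simpa using ((hasDerivAt_id t).smul_const e).const_add z₀
      exact (hδ' (z₀ + t • e) (by rwa [hnorm t ht0])
        (by rw [hnorm t ht0]; exact ht.2.trans_lt hRδ)).1.comp_hasDerivAt t hl)
    (fun t ht => by
      have ht0 := hρ.trans_le ht.1
      have h := (hδ' (z₀ + t • e) (by rwa [hnorm t ht0])
        (by rw [hnorm t ht0]; exact ht.2.trans_lt hRδ)).2
      rw [hnorm t ht0] at h
      have h' := (v' (z₀ + t • e)).le_opNorm e
      rw [hen, mul_one] at h'
      exact h'.trans h)
  have hRM := hM (z₀ + R • e) (by rw [mem_sphere_iff_norm, hnorm R hRpos])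
  rw [Real.norm_eq_abs] at hRM
  rw [div_le_iff₀ (half_pos hε)] at hzM
  simp only [hz] at hmain
  rw [Real.norm_eq_abs, Real.norm_of_nonneg (zpow_nonneg hρ.le n)]
  linarith

lemma hasFDerivAt_re_mul_zpow {z₀ z : ℂ} (hz : z ≠ z₀) (a : ℂ) {n : ℤ} (hn : n ≠ 0) :
    HasFDerivAt (fun z : ℂ => 1 / (n : ℝ) * (a * (z - z₀) ^ n).re)
      (reCLM.comp ((a * (z - z₀) ^ (n - 1)) • (1 : ℂ →L[ℝ] ℂ))) z := by
  have hnC : (n : ℂ) ≠ 0 := by exact_mod_cast hn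
  have hd : HasDerivAt (fun z : ℂ => 1 / (n : ℂ) * (a * (z - z₀) ^ n)) (a * (z - z₀) ^ (n - 1)) z := by
    exact (((hasDerivAt_zpow n (z - z₀) (Or.inl (sub_ne_zero.2 hz))).comp z
      ((hasDerivAt_id z).sub_const z₀)).const_mul a).const_mul (1 / (n : ℂ)) |>.congr_deriv
      (by field_simp)
  refine (reCLM.hasFDerivAt.comp z hd.complexToReal_fderiv).congr_of_eventuallyEq
    (Eventually.of_forall fun w => ?_)
  have : (1 / (n : ℂ)) = ((1 / (n : ℝ) : ℝ) : ℂ) := by push_cast; rfl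
  simp only [Function.comp, reCLM_apply, this, re_ofReal_mul]

lemma norm_le_norm_partials (L : ℂ →L[ℝ] ℝ) :
    ‖L‖ ≤ 2 * ‖(L I : ℂ) + (L 1 : ℂ) * I‖ := by
  refine L.opNorm_le_bound (by positivity) fun w => ?_
  have hw : L w = w.re * L 1 + w.im * L I := by
    conv_lhs => rw [← re_add_im w, show (w.re : ℂ) + w.im * I = w.re • (1 : ℂ) + w.im • I by simp]
    rw [map_add, map_smul, map_smul, smul_eq_mul, smul_eq_mul]
  have h1 := abs_im_le_norm ((L I : ℂ) + (L 1 : ℂ) * I)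
  have h2 := abs_re_le_norm ((L I : ℂ) + (L 1 : ℂ) * I)
  simp only [add_im, add_re, ofReal_im, ofReal_re, mul_im, mul_re, I_re, I_im, mul_zero, mul_one,
    zero_add, add_zero, sub_zero] at h1 h2
  rw [hw, Real.norm_eq_abs]
  calc |w.re * L 1 + w.im * L I| ≤ |w.re| * |L 1| + |w.im| * |L I| := by
        simpa only [abs_mul] using abs_add_le (w.re * L 1) (w.im * L I)
    _ ≤ ‖w‖ * ‖(L I : ℂ) + (L 1 : ℂ) * I‖ + ‖w‖ * ‖(L I : ℂ) + (L 1 : ℂ) * I‖ := by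
        gcongr
        exacts [abs_re_le_norm w, abs_im_le_norm w]
    _ = _ := by ring

theorem stmt7
    (z₀ : ℂ) (r : ℝ) (hr : 0 < r)
    (u : ℂ → ℝ) (hu : ContDiffOn ℝ 2 u (Metric.ball z₀ r \ {z₀}))
    (hharm : ∀ z ∈ Metric.ball z₀ r \ {z₀}, pX (pX u) z + pY (pY u) z = 0)
    (f : ℂ → ℂ) (hf : f = fun z => (pY u z : ℂ) + (pX u z : ℂ) * Complex.I)
    (n : ℤ) (hn : n ≤ -1)
    (c₁ c₂ : ℝ) (hc : c₁ ≠ 0 ∨ c₂ ≠ 0)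
    (hasymp : (fun z => f z - ((c₂ : ℂ) + (c₁ : ℂ) * Complex.I) * (z - z₀) ^ (n - 1))
      =o[𝓝[≠] z₀] fun z => ‖z - z₀‖ ^ (n - 1)) :
    (fun z => u z - (1 / (n : ℝ)) *
        (((c₁ : ℂ) - (c₂ : ℂ) * Complex.I) * (z - z₀) ^ n).re)
      =o[𝓝[≠] z₀] fun z => ‖z - z₀‖ ^ n := by
  have hopen : IsOpen (Metric.ball z₀ r \ {z₀}) := Metric.isOpen_ball.sdiff isClosed_singleton
  have hmem : Metric.ball z₀ r \ {z₀} ∈ 𝓝[≠] z₀ :=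
    sdiff_mem_nhdsWithin_compl (Metric.ball_mem_nhds z₀ hr) _
  refine isLittleO_zpow_of_fderiv_isLittleO hn (v' := fun z => fderiv ℝ u z -
    reCLM.comp ((((c₁ : ℂ) - (c₂ : ℂ) * I) * (z - z₀) ^ (n - 1)) • (1 : ℂ →L[ℝ] ℂ))) ?_ ?_
  · filter_upwards [hmem] with z hz
    exact ((hu.differentiableOn two_ne_zero).differentiableAt
      (hopen.mem_nhds hz)).hasFDerivAt.sub (hasFDerivAt_re_mul_zpow hz.2 _ (by omega))
  · refine (IsBigO.of_bound 2 (Eventually.of_forall fun z => ?_)).trans_isLittleO hasymp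
    refine (norm_le_norm_partials _).trans_eq ?_
    congr 2
    apply Complex.ext <;> simp [hf, pX, pY] <;> ring
end

section
/- Let z₀ ∈ ℂ, let u be a harmonic function on a punctured open disk around z₀, let f = u_y + i u_x, and let c₁, c₂ ∈ ℝ be constants, not both zero, such that f(z) = (c₂ + i c₁)(z − z₀)^{−1} + o(|z − z₀|^{−1}) as z → z₀. Then u(z) = c₁ log|z − z₀| + o(|log|z − z₀||) as z → z₀. -/
open Complex Set Filter Topology Asymptotics

/-- The derivative of `g` at `z` in the direction `q`, as an imaginary part. -/
lemma fderiv_apply_eq_im (g : ℂ → ℝ) (z q : ℂ) :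
    fderiv ℝ g z q = (((pY g z : ℂ) + (pX g z : ℂ) * Complex.I) * q).im := by
  have hq : q = q.re • (1 : ℂ) + q.im • Complex.I := by
    apply Complex.ext <;> simp
  conv_lhs => rw [hq]
  rw [map_add, map_smul, map_smul]
  simp [pX, pY]
  ring

/-- If `f - c / (z - z₀)` is bounded by `ε / ‖z - z₀‖` on a closed punctured disk of radius `δ`,
then `u - Im c * log ‖z - z₀‖` grows along radii at most like `ε * log (δ / ‖z - z₀‖)`. -/
lemma abs_radial_sub_le {z₀ : ℂ} {u : ℂ → ℝ} {c : ℂ} {δ ε : ℝ} (hδ : 0 < δ)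
    (hdiff : ∀ z, z ≠ z₀ → ‖z - z₀‖ ≤ δ → DifferentiableAt ℝ u z)
    (hbound : ∀ z, z ≠ z₀ → ‖z - z₀‖ ≤ δ →
      ‖((pY u z : ℂ) + (pX u z : ℂ) * Complex.I) - c * (z - z₀)⁻¹‖ ≤ ε * ‖z - z₀‖⁻¹)
    {w : ℂ} (hw : ‖w‖ = 1) {s : ℝ} (hs : s ≤ Real.log δ) :
    |(u (z₀ + Real.exp s * w) - c.im * s) - (u (z₀ + δ * w) - c.im * Real.log δ)|
      ≤ ε * (Real.log δ - s) := by
  have hw0 : w ≠ 0 := by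
    rintro rfl
    simp at hw
  have hexp (t : ℝ) : HasDerivAt (fun t : ℝ => z₀ + (Real.exp t : ℂ) * w)
      ((Real.exp t : ℂ) * w) t :=
    ((Real.hasDerivAt_exp t).ofReal_comp.mul_const w).const_add z₀
  have hderiv : ∀ t ∈ Iic (Real.log δ),
      HasDerivWithinAt (fun t : ℝ => u (z₀ + (Real.exp t : ℂ) * w) - c.im * t)
        (fderiv ℝ u (z₀ + (Real.exp t : ℂ) * w) ((Real.exp t : ℂ) * w) - c.im)
        (Iic (Real.log δ)) t ∧
      ‖fderiv ℝ u (z₀ + (Real.exp t : ℂ) * w) ((Real.exp t : ℂ) * w) - c.im‖ ≤ ε := by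
    intro t ht
    set q : ℂ := (Real.exp t : ℂ) * w with hq
    have hq0 : q ≠ 0 := mul_ne_zero (by exact_mod_cast (Real.exp_pos t).ne') hw0
    have hqn : ‖q‖ = Real.exp t := by
      rw [hq, norm_mul, hw, mul_one, Complex.norm_real, Real.norm_of_nonneg (Real.exp_pos t).le]
    have hne : z₀ + q ≠ z₀ := by simpa using hq0
    have hle : ‖z₀ + q - z₀‖ ≤ δ := by
      rw [add_sub_cancel_left, hqn]
      exact (Real.le_log_iff_exp_le hδ).1 ht
    refine ⟨HasDerivAt.hasDerivWithinAt ?_, ?_⟩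
    · have h1 := (hdiff _ hne hle).hasFDerivAt.comp_hasDerivAt t (hexp t)
      have h2 := h1.sub ((hasDerivAt_id t).const_mul c.im)
      rwa [mul_one] at h2
    · have hb := hbound _ hne hle
      rw [add_sub_cancel_left] at hb
      have hkey : fderiv ℝ u (z₀ + q) q - c.im =
          ((((pY u (z₀ + q) : ℂ) + (pX u (z₀ + q) : ℂ) * Complex.I) - c * q⁻¹) * q).im := by
        rw [fderiv_apply_eq_im, sub_mul, mul_assoc c, inv_mul_cancel₀ hq0, mul_one,
          Complex.sub_im]
      rw [hkey, Real.norm_eq_abs]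
      refine (Complex.abs_im_le_norm _).trans ?_
      rw [norm_mul]
      calc _ ≤ ε * ‖q‖⁻¹ * ‖q‖ := by gcongr
        _ = ε := by rw [mul_assoc, inv_mul_cancel₀ (norm_ne_zero_iff.2 hq0), mul_one]
  have h := (convex_Iic (Real.log δ)).norm_image_sub_le_of_norm_hasDerivWithin_le
    (fun t ht => (hderiv t ht).1) (fun t ht => (hderiv t ht).2) self_mem_Iic hs
  simp only [Real.exp_log hδ, Real.norm_eq_abs] at h
  rwa [abs_sub_comm s, abs_of_nonneg (sub_nonneg.2 hs)] at h

theorem stmt8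
    (z₀ : ℂ) (r : ℝ) (hr : 0 < r)
    (u : ℂ → ℝ) (hu : ContDiffOn ℝ 2 u (Metric.ball z₀ r \ {z₀}))
    (hharm : ∀ z ∈ Metric.ball z₀ r \ {z₀}, pX (pX u) z + pY (pY u) z = 0)
    (f : ℂ → ℂ) (hf : f = fun z => (pY u z : ℂ) + (pX u z : ℂ) * Complex.I)
    (c₁ c₂ : ℝ) (hc : c₁ ≠ 0 ∨ c₂ ≠ 0)
    (hasymp : (fun z => f z - ((c₂ : ℂ) + (c₁ : ℂ) * Complex.I) * (z - z₀)⁻¹)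
      =o[𝓝[≠] z₀] fun z => ‖z - z₀‖⁻¹) :
    (fun z => u z - c₁ * Real.log ‖z - z₀‖)
      =o[𝓝[≠] z₀] fun z => |Real.log ‖z - z₀‖| := by
  have hopen : IsOpen (Metric.ball z₀ r \ {z₀}) := Metric.isOpen_ball.sdiff isClosed_singleton
  have hd : ∀ z ∈ Metric.ball z₀ r \ {z₀}, DifferentiableAt ℝ u z := fun z hz =>
    (hu.contDiffAt (hopen.mem_nhds hz)).differentiableAt (by norm_num)
  rw [isLittleO_iff]
  intro ε hε
  obtain ⟨ρ, hρ, hρb⟩ := Metric.eventually_nhds_iff.1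
    (eventually_nhdsWithin_iff.1 (isLittleO_iff.1 hasymp (half_pos hε)))
  obtain ⟨δ, hδ, hδ'⟩ := exists_between (lt_min (lt_min hρ hr) one_pos)
  simp only [lt_min_iff] at hδ'
  obtain ⟨⟨hδρ, hδr⟩, hδ1⟩ := hδ'
  have hdiff : ∀ z, z ≠ z₀ → ‖z - z₀‖ ≤ δ → DifferentiableAt ℝ u z := fun z hz hzδ =>
    hd z ⟨by rw [Metric.mem_ball, dist_eq_norm]; linarith, hz⟩
  have hbound : ∀ z, z ≠ z₀ → ‖z - z₀‖ ≤ δ →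
      ‖((pY u z : ℂ) + (pX u z : ℂ) * Complex.I) - ((c₂ : ℂ) + (c₁ : ℂ) * Complex.I)
        * (z - z₀)⁻¹‖ ≤ ε / 2 * ‖z - z₀‖⁻¹ := by
    intro z hz hzδ
    have h := hρb (y := z) (by rw [dist_eq_norm]; linarith) hz
    simpa [hf] using h
  have hcont : ContinuousOn u (Metric.sphere z₀ δ) := by
    intro z hz
    have hz' : ‖z - z₀‖ = δ := by simpa [dist_eq_norm] using hz
    refine (hdiff z ?_ hz'.le).continuousAt.continuousWithinAt
    rintro rfl
    simp at hz'
    linarith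
  obtain ⟨M, hM⟩ := (isCompact_sphere z₀ δ).exists_bound_of_continuousOn hcont
  have hlog : Tendsto (fun z : ℂ => Real.log ‖z - z₀‖) (𝓝[≠] z₀) atBot :=
    Real.tendsto_log_nhdsGT_zero.comp (tendsto_norm_sub_self_nhdsNE z₀)
  filter_upwards [hlog.eventually_le_atBot (Real.log δ), self_mem_nhdsWithin,
    hlog.eventually_le_atBot (-((M + |c₁ * Real.log δ|) / (ε / 2)))] with z hz1 hz0 hz2
  have hpos : 0 < ‖z - z₀‖ := norm_pos_iff.2 (sub_ne_zero.2 hz0)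
  set w : ℂ := (z - z₀) / ‖z - z₀‖ with hw
  have hwn : ‖w‖ = 1 := by
    rw [hw, norm_div, Complex.norm_real, norm_norm, div_self hpos.ne']
  have hzw : z₀ + (‖z - z₀‖ : ℂ) * w = z := by
    rw [hw, mul_div_cancel₀ _ (by exact_mod_cast hpos.ne')]
    ring
  have h := abs_radial_sub_le hδ hdiff hbound hwn hz1
  rw [Real.exp_log hpos, hzw] at h
  have him : ((c₂ : ℂ) + (c₁ : ℂ) * Complex.I).im = c₁ := by simp
  rw [him] at h
  have hMw := hM (z₀ + δ * w) (by simp [hwn, abs_of_pos hδ])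
  rw [Real.norm_eq_abs] at hMw
  have hlδ : Real.log δ ≤ 0 := Real.log_nonpos hδ.le hδ1.le
  have hM' : M + |c₁ * Real.log δ| ≤ ε / 2 * -Real.log ‖z - z₀‖ := by
    rw [← div_le_iff₀' (half_pos hε)]
    linarith
  rw [Real.norm_eq_abs, Real.norm_eq_abs, abs_abs, abs_of_nonpos (hz1.trans hlδ)]
  have hεδ : ε / 2 * Real.log δ ≤ 0 := mul_nonpos_of_nonneg_of_nonpos (half_pos hε).le hlδ
  calc |u z - c₁ * Real.log ‖z - z₀‖|
      ≤ |u z - c₁ * Real.log ‖z - z₀‖ - (u (z₀ + δ * w) - c₁ * Real.log δ)|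
        + |u (z₀ + δ * w) - c₁ * Real.log δ| := by
        simpa using abs_add_le (u z - c₁ * Real.log ‖z - z₀‖ - (u (z₀ + δ * w) - c₁ * Real.log δ))
          (u (z₀ + δ * w) - c₁ * Real.log δ)
    _ ≤ ε / 2 * (Real.log δ - Real.log ‖z - z₀‖) + (M + |c₁ * Real.log δ|) := by
        refine add_le_add h ((abs_sub _ _).trans ?_)
        gcongr
    _ ≤ ε * -Real.log ‖z - z₀‖ := by linarith
end

section
/- Let n ≥ 1, let V be an open set in ℝ^{n+1}, let u be a smooth harmonic function on V (so Δ_{n+1}u = Σ_{i=1}^{n+1} D_{ii}u = 0 on V), and let Ω = {x ∈ V : x_{n+1} = 0}, regarded as an open subset of ℝⁿ. Write Du = (D_1u, …, D_nu) for the tangential gradient, p = |Du|² + (D_{n+1}u)², q = D_{n+1}p, and σ = sgn(D_{n+1}u). Assume D_{n+1}u ≠ 0 at every point of Ω. Then the restriction of u to Ω satisfies the divergence-form equation div(Du/√(p − |Du|²)) + (1/2)·σq/(p − |Du|²) = 0 on Ω, where div is the divergence operator in the n tangential variables x_1, …, x_n. -/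
open Set Filter Topology

/-- Partial derivative `D_i g` in `EuclideanSpace ℝ (Fin n)`. -/
noncomputable def pd {n : ℕ} (i : Fin n) (g : EuclideanSpace ℝ (Fin n) → ℝ) :
    EuclideanSpace ℝ (Fin n) → ℝ := fun y => fderiv ℝ g y (EuclideanSpace.single i 1)

/-- The embedding of `ℝⁿ` onto the hyperplane `{x_{n+1} = 0}` of `ℝ^{n+1}`. -/
noncomputable def emb (n : ℕ) (x : EuclideanSpace ℝ (Fin n)) :
    EuclideanSpace ℝ (Fin (n + 1)) :=
  (WithLp.equiv 2 (Fin (n + 1) → ℝ)).symm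
    (Fin.snoc (WithLp.equiv 2 (Fin n → ℝ) x) 0)

/-- The embedding of the hyperplane as a continuous linear map. -/
noncomputable def embL (n : ℕ) :
    EuclideanSpace ℝ (Fin n) →L[ℝ] EuclideanSpace ℝ (Fin (n + 1)) :=
  LinearMap.toContinuousLinearMap
    { toFun := emb n
      map_add' := fun x y => by
        ext k
        refine Fin.lastCases ?_ (fun k => ?_) k <;> simp [emb]
      map_smul' := fun c x => by
        ext k
        refine Fin.lastCases ?_ (fun k => ?_) k <;> simp [emb] }

lemma embL_apply (n : ℕ) (x : EuclideanSpace ℝ (Fin n)) : embL n x = emb n x := rfl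

lemma emb_single (n : ℕ) (i : Fin n) :
    emb n (EuclideanSpace.single i 1) = EuclideanSpace.single i.castSucc 1 := by
  ext k
  refine Fin.lastCases ?_ (fun k => ?_) k
  · simp [emb]
  · simp [emb, Pi.single_apply]

lemma pd_comp_emb {n : ℕ} (i : Fin n) {g : EuclideanSpace ℝ (Fin (n + 1)) → ℝ}
    {x : EuclideanSpace ℝ (Fin n)} (hg : DifferentiableAt ℝ g (emb n x)) :
    pd i (fun y => g (emb n y)) x = pd i.castSucc g (emb n x) := by
  have h : HasFDerivAt (fun y => g (emb n y)) ((fderiv ℝ g (emb n x)).comp (embL n)) x :=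
    HasFDerivAt.comp x (f := embL n) hg.hasFDerivAt (embL n).hasFDerivAt
  simp only [pd, h.fderiv, ContinuousLinearMap.comp_apply, embL_apply, emb_single]

section SecondDerivatives

variable {n : ℕ} {u : EuclideanSpace ℝ (Fin n) → ℝ} {z : EuclideanSpace ℝ (Fin n)}

lemma differentiableAt_pd (hu : ContDiffAt ℝ 2 u z) (i : Fin n) :
    DifferentiableAt ℝ (pd i u) z :=
  ((hu.fderiv_right (m := 1) (by norm_num)).differentiableAt (by norm_num)).clm_apply
    (differentiableAt_const _)

lemma pd_pd (hu : ContDiffAt ℝ 2 u z) (i j : Fin n) :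
    pd i (pd j u) z = fderiv ℝ (fderiv ℝ u) z (EuclideanSpace.single i 1)
      (EuclideanSpace.single j 1) := by
  have h := (hu.fderiv_right (m := 1) (by norm_num)).differentiableAt (by norm_num)
  have h' := h.hasFDerivAt.clm_apply (hasFDerivAt_const (EuclideanSpace.single j (1 : ℝ)) z)
  change fderiv ℝ (fun y => fderiv ℝ u y (EuclideanSpace.single j 1)) z _ = _
  rw [h'.fderiv]
  simp

lemma pd_pd_comm (hu : ContDiffAt ℝ 2 u z) (i j : Fin n) :
    pd i (pd j u) z = pd j (pd i u) z := by
  rw [pd_pd hu, pd_pd hu]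
  exact (hu.isSymmSndFDerivAt (by simp)).eq _ _

end SecondDerivatives

section Calculus

variable {n : ℕ} {f g : EuclideanSpace ℝ (Fin n) → ℝ} {z : EuclideanSpace ℝ (Fin n)}

lemma pd_sq (i : Fin n) (hf : DifferentiableAt ℝ f z) :
    pd i (fun y => f y ^ 2) z = 2 * f z * pd i f z := by
  simp [pd, (hf.hasFDerivAt.pow 2).fderiv]

lemma differentiableAt_div_sqrt_sq (hf : DifferentiableAt ℝ f z)
    (hg : DifferentiableAt ℝ g z) (h0 : g z ≠ 0) :
    DifferentiableAt ℝ (fun y => f y / Real.sqrt (g y ^ 2)) z := by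
  have h2 : g z ^ 2 ≠ 0 := pow_ne_zero 2 h0
  exact hf.fun_mul (((hg.pow 2).sqrt h2).fun_inv (by simpa [Real.sqrt_sq_eq_abs] using h0))

lemma pd_div_sqrt_sq (i : Fin n) (hf : DifferentiableAt ℝ f z)
    (hg : DifferentiableAt ℝ g z) (h0 : g z ≠ 0) :
    pd i (fun y => f y / Real.sqrt (g y ^ 2)) z
      = Real.sign (g z) * (pd i f z / g z - f z * pd i g z / g z ^ 2) := by
  have h2 : g z ^ 2 ≠ 0 := pow_ne_zero 2 h0
  have hs : Real.sqrt (g z ^ 2) ≠ 0 := by simpa [Real.sqrt_sq_eq_abs] using h0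
  have h := hf.hasFDerivAt.mul ((hasDerivAt_inv hs).comp_hasFDerivAt z
    ((hg.hasFDerivAt.pow 2).sqrt h2))
  have h' : pd i (fun y => f y / Real.sqrt (g y ^ 2)) z = _ :=
    congrArg (fun L => L (EuclideanSpace.single i 1)) (HasFDerivAt.fderiv h)
  rw [h']
  rcases lt_or_gt_of_ne h0 with hneg | hpos
  · simp [pd, Real.sqrt_sq_eq_abs, abs_of_neg hneg, Real.sign_of_neg hneg]
    field_simp
    ring
  · simp [pd, Real.sqrt_sq_eq_abs, abs_of_pos hpos, Real.sign_of_pos hpos]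
    field_simp
    ring

end Calculus

theorem stmt11
    (n : ℕ) (hn : 1 ≤ n)
    (V : Set (EuclideanSpace ℝ (Fin (n + 1)))) (hV : IsOpen V)
    (u : EuclideanSpace ℝ (Fin (n + 1)) → ℝ) (hu : ContDiffOn ℝ (⊤ : ℕ∞) u V)
    (hharm : ∀ y ∈ V, ∑ i : Fin (n + 1), pd i (pd i u) y = 0)
    -- S = |Du|² (squared norm of the tangential gradient), P = p = |Du|² + (D_{n+1}u)²
    (S P : EuclideanSpace ℝ (Fin (n + 1)) → ℝ)
    (hS : S = fun y => ∑ i : Fin n, (pd i.castSucc u y) ^ 2)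
    (hP : P = fun y => S y + (pd (Fin.last n) u y) ^ 2)
    -- Ω = {x ∈ V : x_{n+1} = 0}, regarded as an open subset of ℝⁿ
    (Ω : Set (EuclideanSpace ℝ (Fin n))) (hΩ : Ω = emb n ⁻¹' V)
    -- D_{n+1}u ≠ 0 at every point of Ω
    (hDlast : ∀ x ∈ Ω, pd (Fin.last n) u (emb n x) ≠ 0) :
    ∀ x ∈ Ω,
      (∑ i : Fin n, pd i
          (fun y => pd i.castSucc u (emb n y) / Real.sqrt (P (emb n y) - S (emb n y))) x)
        + (1 / 2) * (Real.sign (pd (Fin.last n) u (emb n x)) * pd (Fin.last n) P (emb n x))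
            / (P (emb n x) - S (emb n x)) = 0 := by
  subst hP hS hΩ
  intro x hx
  have hu2 : ContDiffAt ℝ 2 u (emb n x) :=
    (hu.contDiffAt (hV.mem_nhds hx)).of_le (by norm_cast)
  have hd := differentiableAt_pd hu2
  have hw : pd (Fin.last n) u (emb n x) ≠ 0 := hDlast x hx
  have hterm (i : Fin n) :
      pd i (fun y => pd i.castSucc u (emb n y) / Real.sqrt (pd (Fin.last n) u (emb n y) ^ 2)) x
        = Real.sign (pd (Fin.last n) u (emb n x)) *
          (pd i.castSucc (pd i.castSucc u) (emb n x) / pd (Fin.last n) u (emb n x)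
            - pd i.castSucc u (emb n x) * pd i.castSucc (pd (Fin.last n) u) (emb n x)
              / pd (Fin.last n) u (emb n x) ^ 2) := by
    rw [pd_comp_emb (g := fun z => pd i.castSucc u z / Real.sqrt (pd (Fin.last n) u z ^ 2)) i
      (differentiableAt_div_sqrt_sq (hd _) (hd _) hw), pd_div_sqrt_sq _ (hd _) (hd _) hw]
  have hq : pd (Fin.last n) (fun y => ∑ i : Fin n, pd i.castSucc u y ^ 2
        + pd (Fin.last n) u y ^ 2) (emb n x)
      = ∑ i : Fin n, 2 * (pd i.castSucc u (emb n x) *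
          pd i.castSucc (pd (Fin.last n) u) (emb n x))
        + 2 * pd (Fin.last n) u (emb n x) * pd (Fin.last n) (pd (Fin.last n) u) (emb n x) := by
    rw [← pd_sq _ (hd _)]
    have h := (HasFDerivAt.fun_sum (u := Finset.univ) fun (i : Fin n) _ =>
      ((hd i.castSucc).pow 2).hasFDerivAt).add ((hd (Fin.last n)).pow 2).hasFDerivAt
    refine (congrArg (fun L => L (EuclideanSpace.single (Fin.last n) 1))
      (HasFDerivAt.fderiv h)).trans ?_
    rw [add_apply, sum_apply]
    congr 1
    refine Finset.sum_congr rfl fun i _ => ?_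
    rw [← mul_assoc, pd_pd_comm hu2, ← pd_sq _ (hd _)]
    rfl
  have hlap := hharm _ hx
  rw [Fin.sum_univ_castSucc] at hlap
  simp only [add_sub_cancel_left]
  rw [hq, Finset.sum_congr rfl fun i _ => hterm i, ← Finset.mul_sum, Finset.sum_sub_distrib,
    ← Finset.sum_div, ← Finset.sum_div, ← Finset.mul_sum, eq_neg_of_add_eq_zero_left hlap]
  field_simp
  ring
end
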